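/- For a transposition $\tau=(a\ b)\in S_d$ with $a<b$ put $\mathrm{top}(\tau)=b$. Let $\mu_1,\mu_2,\nu_1,\nu_2$ be positive integers with $\mu_1+\mu_2=\nu_1+\nu_2=d$, and let $\sigma_\mu=(1\ \dots\ \mu_1)(\mu_1+1\ \dots\ d)\in S_d$. Consider the tuples $(\tau_1,\tau_2,\sigma_2,(B_1,B_2))$ such that $\tau_1,\tau_2\in S_d$ are transpositions, $\sigma_2\in S_d$ satisfies $\sigma_2\tau_2\tau_1\sigma_\mu=\mathrm{id}$, the subgroup generated by $\sigma_\mu,\tau_1,\tau_2,\sigma_2$ acts transitively on $\{1,\dots,d\}$, and $(B_1,B_2)$ is an ordered list of all the orbits of $\sigma_2$ on $\{1,\dots,d\}$, each listed once, with $|B_1|=\nu_1$ and $|B_2|=\nu_2$. Let $M_{0,2,0;(\mu_1,\mu_2),(\nu_1,\nu_2)}$ be the number of such tuples with $\mathrm{top}(\tau_1)<\mathrm{top}(\tau_2)$ (the strictly monotone case), and let $M_{2,0,0;(\mu_1,\mu_2),(\nu_1,\nu_2)}$ be the number of such tuples with $\mathrm{top}(\tau_1)\le\mathrm{top}(\tau_2)$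 (the monotone case). Suppose that $\nu_1<\mu_1<\nu_2$ and $\nu_1<\mu_2<\nu_2$. Then $$M_{0,2,0;(\mu_1,\mu_2),(\nu_1,\nu_2)}=\mu_1\mu_2(\nu_2-1)\qquad\text{and}\qquad M_{2,0,0;(\mu_1,\mu_2),(\nu_1,\nu_2)}=\mu_1\mu_2(\nu_2+1).$$ -/

import Mathlib

/-- The larger moved point of a transposition (as a natural number):
the supremum of the values in its support. -/
def permTop {d : ℕ} (τ : Equiv.Perm (Fin d)) : ℕ := τ.support.sup Fin.val

/-- The `(p,q)`-monotonicity condition on a tuple `(τ₁,…,τ_b)` of transpositions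
(indexed here by `Fin b`, with index `i` corresponding to `τ_{i+1}`):
`top τ_k ≤ top τ_{k+1}` for `1 ≤ k ≤ p-1` and `top τ_k < top τ_{k+1}` for `p ≤ k ≤ p+q-1`. -/
def MonCond {d b : ℕ} (p q : ℕ) (τ : Fin b → Equiv.Perm (Fin d)) : Prop :=
  ∀ i j : Fin b, (j : ℕ) = (i : ℕ) + 1 →
    ((i : ℕ) + 1 < p → permTop (τ i) ≤ permTop (τ j)) ∧
    (p ≤ (i : ℕ) + 1 → (i : ℕ) + 1 < p + q → permTop (τ i) < permTop (τ j))

/-- The permutation `σ_μ` of `{1,…,d}`, `d = μ₁ + ⋯ + μ_m`, whose cycles are the consecutive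
blocks `(1 … μ₁)(μ₁+1 … μ₁+μ₂)⋯`. Points are represented 0-indexed by `Fin d`;
`finSigmaFinEquiv` places the blocks `Fin (μ i)` one after another, and `finRotate` is the
cycle `0 ↦ 1 ↦ ⋯ ↦ μ i - 1 ↦ 0` on a block. -/
def blockCyclePerm {m : ℕ} (μ : Fin m → ℕ) : Equiv.Perm (Fin (∑ i, μ i)) :=
  finSigmaFinEquiv.permCongr (Equiv.sigmaCongrRight fun i => finRotate (μ i))

/-- `B` is an ordered list of the orbits of `σ` on `{1,…,d}` with `|B_j| = ν_j`:
each `B_j` is an orbit (i.e. a cycle, possibly a fixed point), the `B_j` are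
pairwise distinct, every point lies in some `B_j`, and `B_j` has `ν_j` elements. -/
def IsOrbitListing {d n : ℕ} (σ : Equiv.Perm (Fin d)) (ν : Fin n → ℕ)
    (B : Fin n → Set (Fin d)) : Prop :=
  (∀ j, ∃ x : Fin d, B j = {y | σ.SameCycle x y}) ∧
  Function.Injective B ∧
  (∀ x : Fin d, ∃ j, x ∈ B j) ∧
  (∀ j, (B j).ncard = ν j)

/-- `M_{p,q,r;μ,ν}`: the number of tuples `(τ₁,…,τ_b, σ₂, (B₁,…,B_n))`, `b = p+q+r`, where each
`τᵢ` is a transposition, `(τ₁,…,τ_b)` satisfies the `(p,q)`-monotonicity condition,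
`σ₂·τ_b⋯τ₁·σ_μ = id`, the subgroup generated by `σ_μ, τ₁,…,τ_b, σ₂` acts transitively
on `{1,…,d}`, and `(B₁,…,B_n)` is an ordered list of the orbits of `σ₂` with
`|B_j| = ν_j`. -/
noncomputable def Mcount (p q r : ℕ) {m n : ℕ} (μ : Fin m → ℕ) (ν : Fin n → ℕ) : ℕ :=
  Nat.card { t : (Fin (p + q + r) → Equiv.Perm (Fin (∑ i, μ i))) ×
      Equiv.Perm (Fin (∑ i, μ i)) × (Fin n → Set (Fin (∑ i, μ i))) //
    (∀ i, (t.1 i).IsSwap) ∧ MonCond p q t.1 ∧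
    t.2.1 * (List.ofFn t.1).reverse.prod * blockCyclePerm μ = 1 ∧
    MulAction.IsPretransitive
      (Subgroup.closure ({blockCyclePerm μ, t.2.1} ∪ Set.range t.1))
      (Fin (∑ i, μ i)) ∧
    IsOrbitListing t.2.1 ν t.2.2 }

open Equiv Equiv.Perm Finset

set_option linter.unusedSectionVars false

section Orbits

open scoped Classical

variable {α : Type*} [Fintype α]

/-- The orbit of `x` under the permutation `ρ`, as a finset. -/
noncomputable def orbitFinset (ρ : Perm α) (x : α) : Finset α :=
  univ.filter fun y => ρ.SameCycle x y

variable [DecidableEq α]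

theorem mem_orbitFinset {ρ : Perm α} {x y : α} : y ∈ orbitFinset ρ x ↔ ρ.SameCycle x y := by
  simp [orbitFinset]

theorem self_mem_orbitFinset (ρ : Perm α) (x : α) : x ∈ orbitFinset ρ x :=
  mem_orbitFinset.2 (SameCycle.refl _ _)

theorem orbitFinset_eq_of_sameCycle {ρ : Perm α} {x y : α} (h : ρ.SameCycle x y) :
    orbitFinset ρ x = orbitFinset ρ y := by
  ext z
  simp only [mem_orbitFinset]
  exact ⟨fun h' => h.symm.trans h', fun h' => h.trans h'⟩

theorem orbitFinset_disjoint {ρ : Perm α} {x y : α} (h : ¬ ρ.SameCycle x y) :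
    Disjoint (orbitFinset ρ x) (orbitFinset ρ y) := by
  rw [Finset.disjoint_left]
  intro z hx hy
  rw [mem_orbitFinset] at hx hy
  exact h (hx.trans hy.symm)

/-- If `k > 0` is a period of `x`, the orbit consists of the first `k` iterates. -/
theorem orbitFinset_eq_image {ρ : Perm α} {x : α} {k : ℕ} (hk : 0 < k) (h : (ρ ^ k) x = x) :
    orbitFinset ρ x = (range k).image fun j => (ρ ^ j) x := by
  ext z
  simp only [mem_orbitFinset, mem_image, mem_range]
  constructor
  · intro hz
    obtain ⟨i, -, rfl⟩ := hz.exists_pow_eq'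
    refine ⟨i % k, Nat.mod_lt _ hk, ?_⟩
    have hmul : ∀ n : ℕ, (ρ ^ (k * n)) x = x := by
      intro n
      rw [pow_mul]
      exact Function.IsFixedPt.perm_pow h n
    conv_rhs => rw [← Nat.mod_add_div i k, pow_add, Perm.mul_apply, hmul]
  · rintro ⟨j, -, rfl⟩
    exact ⟨j, by simp⟩

theorem card_orbitFinset (ρ : Perm α) (x : α) :
    (orbitFinset ρ x).card = Function.minimalPeriod ρ x := by
  have hpos : 0 < Function.minimalPeriod ρ x := by
    apply Function.minimalPeriod_pos_of_mem_periodicPts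
    exact ⟨orderOf ρ, orderOf_pos ρ, by
      rw [Function.IsPeriodicPt, Function.IsFixedPt, ← Perm.coe_pow, pow_orderOf_eq_one]; rfl⟩
  have hper : (ρ ^ Function.minimalPeriod ρ x) x = x := by
    rw [Perm.coe_pow]
    exact Function.iterate_minimalPeriod
  rw [orbitFinset_eq_image hpos hper, card_image_of_injOn, card_range]
  intro i hi j hj hij
  simp only [coe_range, Set.mem_Iio] at hi hj
  simp only [Perm.coe_pow] at hij
  exact (Function.iterate_eq_iterate_iff_of_lt_minimalPeriod hi hj).1 hij

theorem pow_card_orbitFinset (ρ : Perm α) (x : α) : (ρ ^ (orbitFinset ρ x).card) x = x := by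
  rw [card_orbitFinset, Perm.coe_pow]
  exact Function.iterate_minimalPeriod

theorem card_orbitFinset_pos (ρ : Perm α) (x : α) : 0 < (orbitFinset ρ x).card :=
  card_pos.2 ⟨x, self_mem_orbitFinset ρ x⟩

theorem pow_apply_inj {ρ : Perm α} {x : α} {i j : ℕ} (hi : i < (orbitFinset ρ x).card)
    (hj : j < (orbitFinset ρ x).card) (h : (ρ ^ i) x = (ρ ^ j) x) : i = j := by
  rw [card_orbitFinset] at hi hj
  simp only [Perm.coe_pow] at h
  exact (Function.iterate_eq_iterate_iff_of_lt_minimalPeriod hi hj).1 h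

theorem pow_apply_ne_self {ρ : Perm α} {x : α} {i : ℕ} (h0 : 0 < i)
    (hi : i < (orbitFinset ρ x).card) : (ρ ^ i) x ≠ x := fun e =>
  h0.ne' (pow_apply_inj hi (card_orbitFinset_pos ρ x) (by simpa using e))

theorem exists_pow_of_sameCycle {ρ : Perm α} {x y : α} (h : ρ.SameCycle x y) :
    ∃ k < (orbitFinset ρ x).card, (ρ ^ k) x = y := by
  have := mem_orbitFinset.2 h
  rw [orbitFinset_eq_image (card_orbitFinset_pos ρ x) (pow_card_orbitFinset ρ x)] at this
  simpa using this

theorem exists_pos_pow_of_sameCycle {ρ : Perm α} {x y : α} (h : ρ.SameCycle x y) (hxy : x ≠ y) :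
    ∃ k, 0 < k ∧ k < (orbitFinset ρ x).card ∧ (ρ ^ k) x = y := by
  obtain ⟨k, hk, e⟩ := exists_pow_of_sameCycle h
  refine ⟨k, Nat.pos_of_ne_zero ?_, hk, e⟩
  rintro rfl
  exact hxy (by simpa using e)

/-- As long as the iterates of `z` under `ρ` avoid `x` and `y`, they agree with those
under `swap x y * ρ`. -/
theorem swap_mul_pow_apply {ρ : Perm α} {x y z : α} {n : ℕ}
    (h : ∀ i, 0 < i → i ≤ n → (ρ ^ i) z ≠ x ∧ (ρ ^ i) z ≠ y) :
    ((swap x y * ρ) ^ n) z = (ρ ^ n) z := by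
  induction n with
  | zero => rfl
  | succ n ih =>
    have := h (n + 1) n.succ_pos le_rfl
    have e : (ρ ^ (n + 1)) z = ρ ((ρ ^ n) z) := by rw [pow_succ', Perm.mul_apply]
    rw [pow_succ', Perm.mul_apply, ih fun i hi hn => h i hi (by omega), Perm.mul_apply, ← e,
      swap_apply_of_ne_of_ne this.1 this.2]

theorem orbitFinset_swap_mul_of_not_sameCycle {ρ : Perm α} {x y z : α}
    (hx : ¬ ρ.SameCycle z x) (hy : ¬ ρ.SameCycle z y) :
    orbitFinset (swap x y * ρ) z = orbitFinset ρ z := by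
  have key : ∀ n : ℕ, ((swap x y * ρ) ^ n) z = (ρ ^ n) z := fun n =>
    swap_mul_pow_apply fun i _ _ =>
      ⟨fun e => hx ⟨i, by simpa using e⟩, fun e => hy ⟨i, by simpa using e⟩⟩
  ext w
  simp only [mem_orbitFinset]
  constructor
  · intro h
    obtain ⟨i, -, rfl⟩ := h.exists_pow_eq'
    exact ⟨i, by simp [key]⟩
  · intro h
    obtain ⟨i, -, rfl⟩ := h.exists_pow_eq'
    exact ⟨i, by simp [← key]⟩

section Split

variable {ρ : Perm α} {x y : α} {k : ℕ}

theorem orbitFinset_swap_mul_split (hk : 0 < k) (hkn : k < (orbitFinset ρ x).card)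
    (hy : (ρ ^ k) x = y) :
    orbitFinset (swap x y * ρ) x = (range k).image fun j => (ρ ^ j) x := by
  have key : ∀ j < k, ((swap x y * ρ) ^ j) x = (ρ ^ j) x := fun j hj =>
    swap_mul_pow_apply fun i hi hij =>
      ⟨pow_apply_ne_self hi (by omega),
        fun e => absurd (pow_apply_inj (by omega) hkn (e.trans hy.symm)) (by omega)⟩
  have hper : ((swap x y * ρ) ^ k) x = x := by
    obtain ⟨m, rfl⟩ := Nat.exists_eq_succ_of_ne_zero hk.ne'
    have e : (ρ ^ (m + 1)) x = ρ ((ρ ^ m) x) := by rw [pow_succ', Perm.mul_apply]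
    rw [pow_succ', Perm.mul_apply, key m (by omega), Perm.mul_apply, ← e, hy, swap_apply_right]
  rw [orbitFinset_eq_image hk hper]
  exact image_congr fun j hj => key j (by simpa using hj)

theorem card_orbitFinset_swap_mul_split (hk : 0 < k) (hkn : k < (orbitFinset ρ x).card)
    (hy : (ρ ^ k) x = y) : (orbitFinset (swap x y * ρ) x).card = k := by
  rw [orbitFinset_swap_mul_split hk hkn hy, card_image_of_injOn, card_range]
  intro i hi j hj hij
  simp only [coe_range, Set.mem_Iio] at hi hj
  exact pow_apply_inj (by omega) (by omega) hij

theorem not_sameCycle_swap_mul_split (hk : 0 < k) (hkn : k < (orbitFinset ρ x).card)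
    (hy : (ρ ^ k) x = y) : ¬ (swap x y * ρ).SameCycle x y := by
  rw [← mem_orbitFinset, orbitFinset_swap_mul_split hk hkn hy]
  simp only [mem_image, mem_range, not_exists, not_and]
  intro j hj e
  exact absurd (pow_apply_inj (by omega) hkn (e.trans hy.symm)) (by omega)

theorem pow_sub_apply_eq (hkn : k < (orbitFinset ρ x).card)
    (hy : (ρ ^ k) x = y) : (ρ ^ ((orbitFinset ρ x).card - k)) y = x := by
  rw [← hy, ← Perm.mul_apply, ← pow_add, Nat.sub_add_cancel hkn.le, pow_card_orbitFinset]

theorem card_orbitFinset_swap_mul_split_right (hk : 0 < k) (hkn : k < (orbitFinset ρ x).card)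
    (hy : (ρ ^ k) x = y) :
    (orbitFinset (swap x y * ρ) y).card = (orbitFinset ρ x).card - k := by
  have e : orbitFinset ρ x = orbitFinset ρ y :=
    orbitFinset_eq_of_sameCycle ⟨k, by simpa using hy⟩
  rw [swap_comm]
  exact card_orbitFinset_swap_mul_split (by omega) (by rw [← e]; omega) (pow_sub_apply_eq hkn hy)

end Split

section Join

variable {ρ : Perm α} {x y : α}

theorem orbitFinset_subset_swap_mul_join (h : ¬ ρ.SameCycle x y) :
    orbitFinset ρ x ⊆ orbitFinset (swap x y * ρ) x := by
  intro z hz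
  obtain ⟨j, hj, rfl⟩ := exists_pow_of_sameCycle (mem_orbitFinset.1 hz)
  rw [mem_orbitFinset, ← swap_mul_pow_apply (x := x) (y := y) (n := j)]
  · exact ⟨j, by simp⟩
  · intro i hi hij
    exact ⟨pow_apply_ne_self hi (by omega),
      fun e => h ⟨i, by simpa using e⟩⟩

theorem sameCycle_swap_mul_join (h : ¬ ρ.SameCycle x y) : (swap x y * ρ).SameCycle x y := by
  have hmem : ρ⁻¹ x ∈ orbitFinset ρ x := mem_orbitFinset.2 ⟨-1, by simp⟩
  refine (mem_orbitFinset.1 (orbitFinset_subset_swap_mul_join h hmem)).trans ⟨1, ?_⟩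
  simp

theorem orbitFinset_swap_mul_join (h : ¬ ρ.SameCycle x y) :
    orbitFinset (swap x y * ρ) x = orbitFinset ρ x ∪ orbitFinset ρ y := by
  apply Finset.Subset.antisymm
  · intro z hz
    by_contra hn
    simp only [mem_union, mem_orbitFinset, not_or] at hn
    have e := orbitFinset_swap_mul_of_not_sameCycle (ρ := ρ) (x := x) (y := y) (z := z)
      (fun h => hn.1 h.symm) (fun h => hn.2 h.symm)
    have : x ∈ orbitFinset ρ z := by
      rw [← e]
      exact mem_orbitFinset.2 (mem_orbitFinset.1 hz).symm
    exact hn.1 (mem_orbitFinset.1 this).symm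
  · refine union_subset (orbitFinset_subset_swap_mul_join h) ?_
    rw [orbitFinset_eq_of_sameCycle (sameCycle_swap_mul_join h), swap_comm]
    exact orbitFinset_subset_swap_mul_join fun h' => h h'.symm

theorem card_orbitFinset_swap_mul_join (h : ¬ ρ.SameCycle x y) :
    (orbitFinset (swap x y * ρ) x).card = (orbitFinset ρ x).card + (orbitFinset ρ y).card := by
  rw [orbitFinset_swap_mul_join h, card_union_of_disjoint (orbitFinset_disjoint h)]

end Join

/-- `ρ` has an orbit of size `k` and a different orbit of size `l`. -/
def HasOrbitSizes (ρ : Perm α) (k l : ℕ) : Prop :=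
  ∃ x y, ¬ ρ.SameCycle x y ∧ (orbitFinset ρ x).card = k ∧ (orbitFinset ρ y).card = l

theorem sameCycle_or_of_card_add {ρ : Perm α} {x y : α} (h : ¬ ρ.SameCycle x y)
    (hc : (orbitFinset ρ x).card + (orbitFinset ρ y).card = Fintype.card α) (z : α) :
    ρ.SameCycle x z ∨ ρ.SameCycle y z := by
  have : orbitFinset ρ x ∪ orbitFinset ρ y = univ := by
    rw [← card_eq_iff_eq_univ, card_union_of_disjoint (orbitFinset_disjoint h), hc]
  have hz := mem_univ z
  rw [← this] at hz
  simpa [mem_orbitFinset] using hz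

theorem hasOrbitSizes_iff {ρ : Perm α} {x y : α} {k l : ℕ} (h : ¬ ρ.SameCycle x y)
    (hc : (orbitFinset ρ x).card + (orbitFinset ρ y).card = Fintype.card α)
    (hkl : k + l = Fintype.card α) :
    HasOrbitSizes ρ k l ↔ (orbitFinset ρ x).card = k ∨ (orbitFinset ρ x).card = l := by
  constructor
  · rintro ⟨x', y', -, rfl, rfl⟩
    rcases sameCycle_or_of_card_add h hc x' with h' | h'
    · exact .inl (by rw [orbitFinset_eq_of_sameCycle h'])
    · right
      have := orbitFinset_eq_of_sameCycle h'
      rw [this] at hc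
      omega
  · rintro (e | e)
    · exact ⟨x, y, h, e, by omega⟩
    · exact ⟨y, x, fun h' => h h'.symm, by omega, e⟩

end Orbits

section TwoOrbits

open scoped Classical

variable {α : Type*} [Fintype α] [DecidableEq α]

theorem eq_or_eq_of_swap_eq_swap {x y x' y' : α} (hxy : x ≠ y) (h : swap x y = swap x' y') :
    (x = x' ∧ y = y') ∨ (x = y' ∧ y = x') := by
  have hx : swap x' y' x = y := by rw [← h, swap_apply_left]
  have hy : swap x' y' y = x := by rw [← h, swap_apply_right]
  rw [swap_apply_def] at hx hy
  split_ifs at hx hy <;> grind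

theorem eq_of_swap_eq_swap_of_mem {A : Finset α} {p q p' q' : α} (hp : p ∈ A) (hq : q ∉ A)
    (hq' : q' ∉ A) (h : swap p q = swap p' q') : p = p' ∧ q = q' := by
  have hpq : p ≠ q := by
    rintro rfl
    exact hq hp
  rcases eq_or_eq_of_swap_eq_swap hpq h with h | h
  · exact h
  · exact absurd (h.1 ▸ hp) hq'

/-! ### Splitting a full cycle -/

section FullCycle

variable {ρ : Perm α} {k l : ℕ}

theorem orbitFinset_eq_univ (hρ : ∀ x y, ρ.SameCycle x y) (x : α) : orbitFinset ρ x = univ := by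
  ext y
  simp [mem_orbitFinset, hρ x y]

theorem hasOrbitSizes_swap_mul_fullCycle_iff (hρ : ∀ x y, ρ.SameCycle x y) (hk : 0 < k)
    (hl : 0 < l) (hkl : k + l = Fintype.card α) {x y : α} (hxy : x ≠ y) :
    HasOrbitSizes (swap x y * ρ) k l ↔ (ρ ^ k) x = y ∨ (ρ ^ k) y = x := by
  have hcard : ∀ z, (orbitFinset ρ z).card = Fintype.card α := fun z => by
    rw [orbitFinset_eq_univ hρ, card_univ]
  obtain ⟨j, hj0, hj, e⟩ := exists_pos_pow_of_sameCycle (hρ x y) hxy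
  have e' := pow_sub_apply_eq hj e
  rw [hasOrbitSizes_iff (not_sameCycle_swap_mul_split hj0 hj e) _ hkl,
    card_orbitFinset_swap_mul_split hj0 hj e]
  · rw [hcard] at hj e'
    constructor
    · rintro (rfl | rfl)
      · exact .inl e
      · right
        rwa [show k = Fintype.card α - j by omega]
    · rintro (h | h)
      · left
        exact pow_apply_inj (by rw [hcard]; omega) (by rw [hcard]; omega) (e.trans h.symm)
      · right
        have := pow_apply_inj (by rw [hcard]; omega) (by rw [hcard]; omega) (e'.trans h.symm)
        omega
  · rw [card_orbitFinset_swap_mul_split hj0 hj e, card_orbitFinset_swap_mul_split_right hj0 hj e,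
      hcard]
    rw [hcard] at hj
    omega

theorem pow_apply_ne_of_fullCycle (hρ : ∀ x y, ρ.SameCycle x y) (hk : 0 < k)
    (hkd : k < Fintype.card α) (x : α) : x ≠ (ρ ^ k) x :=
  (pow_apply_ne_self hk (by rwa [orbitFinset_eq_univ hρ, card_univ])).symm

theorem swap_pow_injective_of_fullCycle (hρ : ∀ x y, ρ.SameCycle x y) (hk : 0 < k)
    (hkd : k + k < Fintype.card α) : Function.Injective fun x => swap x ((ρ ^ k) x) := by
  intro x x' h
  rcases eq_or_eq_of_swap_eq_swap (pow_apply_ne_of_fullCycle hρ hk (by omega) x) h with h | h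
  · exact h.1
  · have h2 : (ρ ^ (k + k)) x' = x' := by
      rw [pow_add, Perm.mul_apply, ← h.1, h.2]
    exact absurd h2.symm (pow_apply_ne_of_fullCycle hρ (by omega) hkd x')

end FullCycle

/-! ### A permutation with exactly two orbits `A` and `Aᶜ` -/

/-- The orbits of `σ` are `A` and its complement. -/
def HasOrbitPair (σ : Perm α) (A : Finset α) : Prop :=
  ∀ x y, σ.SameCycle x y ↔ (x ∈ A ↔ y ∈ A)

variable {σ : Perm α} {A : Finset α} {k l : ℕ}

theorem HasOrbitPair.compl (h : HasOrbitPair σ A) : HasOrbitPair σ Aᶜ := fun x y => by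
  rw [h x y]
  simp [not_iff_not]

theorem HasOrbitPair.orbitFinset_of_mem (h : HasOrbitPair σ A) {x : α} (hx : x ∈ A) :
    orbitFinset σ x = A := by
  ext y
  simp [mem_orbitFinset, h x y, hx]

theorem HasOrbitPair.orbitFinset_of_notMem (h : HasOrbitPair σ A) {x : α} (hx : x ∉ A) :
    orbitFinset σ x = Aᶜ :=
  h.compl.orbitFinset_of_mem (by simpa using hx)

theorem HasOrbitPair.sameCycle_swap_mul (h : HasOrbitPair σ A) {p q : α} (hp : p ∈ A)
    (hq : q ∉ A) (x y : α) : (swap p q * σ).SameCycle x y := by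
  have hpq : ¬ σ.SameCycle p q := by rw [h p q]; tauto
  have key : orbitFinset (swap p q * σ) p = univ := by
    rw [orbitFinset_swap_mul_join hpq, h.orbitFinset_of_mem hp, h.orbitFinset_of_notMem hq,
      union_compl]
  have : ∀ z, (swap p q * σ).SameCycle p z := fun z => by
    rw [← mem_orbitFinset, key]
    exact mem_univ z
  exact (this x).symm.trans (this y)

theorem HasOrbitPair.pow_mem (h : HasOrbitPair σ A) {x : α} (hx : x ∈ A) (j : ℕ) :
    (σ ^ j) x ∈ A :=
  ((h x _).1 ⟨j, by simp⟩).1 hx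

theorem HasOrbitPair.pow_apply_ne_self (h : HasOrbitPair σ A) (hk : 0 < k) (hkA : k < A.card)
    {x : α} (hx : x ∈ A) : x ≠ (σ ^ k) x :=
  (_root_.pow_apply_ne_self hk (by rwa [h.orbitFinset_of_mem hx])).symm

theorem HasOrbitPair.orbitFinset_split_subset (h : HasOrbitPair σ A) {x y : α} (hx : x ∈ A)
    (hy : y ∈ A) : orbitFinset (swap x y * σ) x ⊆ A := by
  intro z hz
  by_contra hzA
  have e := orbitFinset_swap_mul_of_not_sameCycle (ρ := σ) (x := x) (y := y) (z := z)
    (by rw [h]; tauto) (by rw [h]; tauto)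
  have hx' : x ∈ orbitFinset (swap x y * σ) z :=
    mem_orbitFinset.2 (mem_orbitFinset.1 hz).symm
  rw [e, h.orbitFinset_of_notMem hzA] at hx'
  simp [hx] at hx'

theorem HasOrbitPair.orbitFinset_split_union (h : HasOrbitPair σ A) {x y : α} (hx : x ∈ A)
    (hy : y ∈ A) (hxy : x ≠ y) :
    orbitFinset (swap x y * σ) x ∪ orbitFinset (swap x y * σ) y = A := by
  obtain ⟨j, hj0, hj, e⟩ := exists_pos_pow_of_sameCycle ((h x y).2 (by tauto)) hxy
  apply eq_of_subset_of_card_le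
  · refine union_subset (h.orbitFinset_split_subset hx hy) ?_
    rw [swap_comm]
    exact h.orbitFinset_split_subset hy hx
  · rw [card_union_of_disjoint (orbitFinset_disjoint (not_sameCycle_swap_mul_split hj0 hj e)),
      card_orbitFinset_swap_mul_split hj0 hj e, card_orbitFinset_swap_mul_split_right hj0 hj e,
      h.orbitFinset_of_mem hx]
    omega

/-- Cutting `A` by `swap x y` and joining the part not containing `x` with `Aᶜ` yields orbits of
sizes `k` and `l` exactly if the part containing `x` has size `k`. -/
theorem HasOrbitPair.hasOrbitSizes_split_join_iff (h : HasOrbitPair σ A) (hk : 0 < k)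
    (hkA : k < A.card) (hAl : A.card < l) (hkl : k + l = Fintype.card α) {x y p q : α}
    (hx : x ∈ A) (hy : y ∈ A) (hxy : x ≠ y) (hp : p ∈ A) (hq : q ∉ A)
    (hpx : p ∉ orbitFinset (swap x y * σ) x) :
    HasOrbitSizes (swap p q * (swap x y * σ)) k l ↔ (σ ^ k) x = y := by
  obtain ⟨j, hj0, hj, e⟩ := exists_pos_pow_of_sameCycle ((h x y).2 (by tauto)) hxy
  have hA := h.orbitFinset_of_mem hx
  have hcx := card_orbitFinset_swap_mul_split hj0 hj e
  have hcy := card_orbitFinset_swap_mul_split_right hj0 hj e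
  have hpy : p ∈ orbitFinset (swap x y * σ) y := by
    have := h.orbitFinset_split_union hx hy hxy
    rw [← this, mem_union] at hp
    exact hp.resolve_left hpx
  have eq : orbitFinset (swap x y * σ) q = Aᶜ := by
    rw [orbitFinset_swap_mul_of_not_sameCycle (by rw [h]; tauto) (by rw [h]; tauto),
      h.orbitFinset_of_notMem hq]
  have ep := orbitFinset_eq_of_sameCycle (mem_orbitFinset.1 hpy)
  have hqp : ¬ (swap x y * σ).SameCycle p q := fun h' => by
    have := mem_orbitFinset.2 h'.symm
    rw [eq] at this
    simp [hp] at this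
  have hqx : ¬ (swap x y * σ).SameCycle x q := fun h' => by
    have := mem_orbitFinset.2 h'.symm
    rw [eq] at this
    simp [hx] at this
  have ex : orbitFinset (swap p q * (swap x y * σ)) x = orbitFinset (swap x y * σ) x :=
    orbitFinset_swap_mul_of_not_sameCycle (fun h' => hpx (mem_orbitFinset.2 h')) hqx
  have hxp : ¬ (swap p q * (swap x y * σ)).SameCycle x p := by
    rw [← mem_orbitFinset, ex]
    exact hpx
  have hcp : (orbitFinset (swap p q * (swap x y * σ)) p).card = A.card - j + Aᶜ.card := by
    rw [card_orbitFinset_swap_mul_join hqp, ← ep, hcy, eq, hA]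
  have hAc := card_add_card_compl A
  rw [hA] at hj
  rw [hasOrbitSizes_iff hxp (by rw [ex, hcx, hcp]; omega) hkl, ex, hcx]
  constructor
  · rintro (rfl | rfl)
    · exact e
    · omega
  · intro h'
    left
    exact pow_apply_inj (by rw [hA]; omega) (by rw [hA]; omega) (e.trans h'.symm)

end TwoOrbits

section Factorizations

open scoped Classical

variable {α : Type*} [Fintype α] [DecidableEq α]

/-- `τ` maps `A` to itself and its complement to itself. -/
def Preserves (A : Finset α) (τ : Perm α) : Prop := ∀ z, z ∈ A ↔ τ z ∈ A

theorem preserves_swap_iff {A : Finset α} {x y : α} :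
    Preserves A (swap x y) ↔ (x ∈ A ↔ y ∈ A) := by
  constructor
  · intro h
    simpa using h x
  · intro h z
    rw [swap_apply_def]
    split_ifs with h1 h2
    · rw [h1, h]
    · rw [h2, h]
    · rfl

theorem Preserves.mul {A : Finset α} {τ τ' : Perm α} (h : Preserves A τ) (h' : Preserves A τ') :
    Preserves A (τ * τ') := fun z => (h' z).trans (h (τ' z))

theorem exists_swap_of_not_preserves {A : Finset α} {τ : Perm α} (hτ : τ.IsSwap)
    (h : ¬ Preserves A τ) : ∃ p ∈ A, ∃ q ∉ A, τ = swap p q := by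
  obtain ⟨x, y, -, rfl⟩ := hτ
  rw [preserves_swap_iff] at h
  by_cases hx : x ∈ A
  · exact ⟨x, hx, y, by tauto, rfl⟩
  · exact ⟨y, by tauto, x, hx, swap_comm _ _⟩

theorem not_preserves_swap {A : Finset α} {p q : α} (hp : p ∈ A) (hq : q ∉ A) :
    ¬ Preserves A (swap p q) := by
  rw [preserves_swap_iff]
  tauto

/-- Pairs of transpositions, not both preserving `A`, whose product with `σ` has orbits of sizes
`k` and `l`. -/
def IsFactorization (σ : Perm α) (A : Finset α) (k l : ℕ) (t : Perm α × Perm α) : Prop :=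
  t.1.IsSwap ∧ t.2.IsSwap ∧ ¬ (Preserves A t.1 ∧ Preserves A t.2) ∧
    HasOrbitSizes (t.2 * t.1 * σ) k l

/-- The factorizations that first cut `A` and then join a part of it with `Aᶜ`. -/
def IsCutJoin (σ : Perm α) (A : Finset α) (k l : ℕ) (t : Perm α × Perm α) : Prop :=
  (∃ x ∈ A, ∃ y ∈ A, x ≠ y ∧ t.1 = swap x y) ∧ (∃ p ∈ A, ∃ q ∉ A, t.2 = swap p q) ∧
    HasOrbitSizes (t.2 * t.1 * σ) k l

variable {σ : Perm α} {A : Finset α} {k l : ℕ}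

theorem card_joinFirst (h : HasOrbitPair σ A) (hk : 0 < k) (hkl' : k < l)
    (hkl : k + l = Fintype.card α) :
    (univ.filter fun t => IsFactorization σ A k l t ∧ ¬ Preserves A t.1).card =
      A.card * Aᶜ.card * Fintype.card α := by
  rw [← card_univ (α := α), ← card_product, ← card_product]
  symm
  apply card_bij fun (c : (α × α) × α) _ =>
    (swap c.1.1 c.1.2, swap c.2 (((swap c.1.1 c.1.2 * σ) ^ k) c.2))
  · rintro ⟨⟨p, q⟩, x⟩ hc
    simp only [mem_product, mem_compl, mem_univ, and_true] at hc
    have hρ := h.sameCycle_swap_mul hc.1 hc.2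
    have hne := pow_apply_ne_of_fullCycle hρ hk (by omega) x
    have hnp := not_preserves_swap hc.1 hc.2
    refine mem_filter.2
      ⟨mem_univ _, ⟨⟨p, q, ?_, rfl⟩, ⟨_, _, hne, rfl⟩, fun h' => hnp h'.1, ?_⟩, hnp⟩
    · rintro rfl
      exact hc.2 hc.1
    · rw [mul_assoc, hasOrbitSizes_swap_mul_fullCycle_iff hρ hk (by omega) hkl hne]
      exact .inl rfl
  · rintro ⟨⟨p, q⟩, x⟩ hc ⟨⟨p', q'⟩, x'⟩ hc' he
    simp only [mem_product, mem_compl, mem_univ, and_true] at hc hc'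
    simp only [Prod.mk.injEq] at he
    obtain ⟨rfl, rfl⟩ := eq_of_swap_eq_swap_of_mem hc.1 hc.2 hc'.2 he.1
    have hρ := h.sameCycle_swap_mul hc.1 hc.2
    have := swap_pow_injective_of_fullCycle hρ hk (by omega) he.2
    rw [this]
  · rintro ⟨τ₁, τ₂⟩ ht
    obtain ⟨-, ⟨h1, ⟨x, y, hxy, h2⟩, -, ho⟩, hn⟩ := mem_filter.1 ht
    dsimp only at h1 h2 ho hn
    subst h2
    obtain ⟨p, hp, q, hq, rfl⟩ := exists_swap_of_not_preserves h1 hn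
    have hρ := h.sameCycle_swap_mul hp hq
    rw [mul_assoc, hasOrbitSizes_swap_mul_fullCycle_iff hρ hk (by omega) hkl hxy] at ho
    rcases ho with e | e
    · exact ⟨((p, q), x), by simp [hp, hq], by simp only [e]⟩
    · exact ⟨((p, q), y), by simp [hp, hq], by simp only [e, swap_comm]⟩

theorem card_cutJoin (h : HasOrbitPair σ A) (hk : 0 < k) (hkA : k < A.card) (hAl : A.card < l)
    (hkl : k + l = Fintype.card α) :
    (univ.filter (IsCutJoin σ A k l)).card = A.card * ((A.card - k) * Aᶜ.card) := by
  have hcard : (A.sigma fun x =>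
      (A \ orbitFinset (swap x ((σ ^ k) x) * σ) x) ×ˢ Aᶜ).card =
      A.card * ((A.card - k) * Aᶜ.card) := by
    rw [card_sigma, sum_const_nat]
    intro x hx
    rw [card_product, card_sdiff_of_subset (h.orbitFinset_split_subset hx (h.pow_mem hx k)),
      card_orbitFinset_swap_mul_split hk (by rwa [h.orbitFinset_of_mem hx]) rfl]
  rw [← hcard]
  symm
  apply card_bij fun (c : (_ : α) × α × α) _ =>
    (swap c.1 ((σ ^ k) c.1), swap c.2.1 c.2.2)
  · rintro ⟨x, p, q⟩ hc
    simp only [mem_sigma, mem_product, mem_sdiff, mem_compl] at hc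
    obtain ⟨hx, ⟨hp, hpx⟩, hq⟩ := hc
    have hne := h.pow_apply_ne_self hk hkA hx
    simp only [mem_filter, mem_univ, true_and, IsCutJoin]
    refine ⟨⟨x, hx, _, h.pow_mem hx k, hne, rfl⟩, ⟨p, hp, q, hq, rfl⟩, ?_⟩
    rw [mul_assoc,
      h.hasOrbitSizes_split_join_iff hk hkA hAl hkl hx (h.pow_mem hx k) hne hp hq hpx]
  · rintro ⟨x, p, q⟩ hc ⟨x', p', q'⟩ hc' he
    simp only [mem_sigma, mem_product, mem_sdiff, mem_compl] at hc hc'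
    obtain ⟨hx, ⟨hp, hpx⟩, hq⟩ := hc
    obtain ⟨hx', ⟨hp', hpx'⟩, hq'⟩ := hc'
    simp only [Prod.mk.injEq] at he
    obtain ⟨rfl, rfl⟩ := eq_of_swap_eq_swap_of_mem hp hq hq' he.2
    have hne := h.pow_apply_ne_self hk hkA hx
    rcases eq_or_eq_of_swap_eq_swap hne he.1 with e | e
    · rw [e.1]
    · exfalso
      rw [← he.1, ← e.2] at hpx'
      rw [← h.orbitFinset_split_union hx (h.pow_mem hx k) hne, mem_union] at hp
      tauto
  · rintro ⟨τ₁, τ₂⟩ ht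
    simp only [mem_filter, mem_univ, true_and, IsCutJoin] at ht
    obtain ⟨⟨x, hx, y, hy, hxy, rfl⟩, ⟨p, hp, q, hq, rfl⟩, ho⟩ := ht
    rw [mul_assoc] at ho
    by_cases hpx : p ∈ orbitFinset (swap x y * σ) x
    · have hpy : p ∉ orbitFinset (swap y x * σ) y := by
        obtain ⟨j, hj0, hj, e⟩ := exists_pos_pow_of_sameCycle ((h x y).2 (by tauto)) hxy
        have := orbitFinset_disjoint (not_sameCycle_swap_mul_split hj0 hj e)
        rw [swap_comm y x]
        exact Finset.disjoint_left.1 this hpx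
      rw [swap_comm x y,
        h.hasOrbitSizes_split_join_iff hk hkA hAl hkl hy hx hxy.symm hp hq hpy] at ho
      refine ⟨⟨y, p, q⟩, ?_, by simp only [ho, swap_comm]⟩
      simp only [mem_sigma, mem_product, mem_sdiff, mem_compl, ho]
      exact ⟨hy, ⟨hp, hpy⟩, hq⟩
    · rw [h.hasOrbitSizes_split_join_iff hk hkA hAl hkl hx hy hxy hp hq hpx] at ho
      refine ⟨⟨x, p, q⟩, ?_, by simp only [ho]⟩
      simp only [mem_sigma, mem_product, mem_sdiff, mem_compl, ho]
      exact ⟨hx, ⟨hp, hpx⟩, hq⟩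

theorem isFactorization_and_preserves_iff {t : Perm α × Perm α} :
    IsFactorization σ A k l t ∧ Preserves A t.1 ↔
      IsCutJoin σ A k l t ∨ IsCutJoin σ Aᶜ k l t := by
  obtain ⟨τ₁, τ₂⟩ := t
  constructor
  · rintro ⟨⟨⟨x, y, hxy, rfl⟩, h2, hn, ho⟩, hp⟩
    obtain ⟨p, hpA, q, hq, rfl⟩ := exists_swap_of_not_preserves h2 fun h' => hn ⟨hp, h'⟩
    rw [preserves_swap_iff] at hp
    by_cases hx : x ∈ A
    · exact .inl ⟨⟨x, hx, y, hp.1 hx, hxy, rfl⟩, ⟨p, hpA, q, hq, rfl⟩, ho⟩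
    · refine .inr ⟨⟨x, by simpa using hx, y, ?_, hxy, rfl⟩,
        ⟨q, by simpa using hq, p, by simpa using hpA, swap_comm _ _⟩, ho⟩
      rw [mem_compl]
      tauto
  · rintro (⟨⟨x, hx, y, hy, hxy, rfl⟩, ⟨p, hp, q, hq, rfl⟩, ho⟩ |
      ⟨⟨x, hx, y, hy, hxy, rfl⟩, ⟨p, hp, q, hq, rfl⟩, ho⟩)
    · refine ⟨⟨⟨x, y, hxy, rfl⟩, ⟨p, q, ?_, rfl⟩, fun h' => not_preserves_swap hp hq h'.2, ho⟩,
        preserves_swap_iff.2 (by tauto)⟩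
      rintro rfl
      exact hq hp
    · rw [mem_compl] at hx hy hp hq
      refine ⟨⟨⟨x, y, hxy, rfl⟩, ⟨p, q, ?_, rfl⟩,
        fun h' => hp ((preserves_swap_iff.1 h'.2).2 (by tauto)), ho⟩,
        preserves_swap_iff.2 (by tauto)⟩
      rintro rfl
      tauto

theorem not_isCutJoin_compl {t : Perm α × Perm α} (h : IsCutJoin σ A k l t) :
    ¬ IsCutJoin σ Aᶜ k l t := by
  rintro ⟨⟨x, hx, y, hy, -, e⟩, -⟩
  obtain ⟨⟨x', hx', y', hy', hne, e'⟩, -⟩ := h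
  rw [mem_compl] at hx hy
  rcases eq_or_eq_of_swap_eq_swap hne (e'.symm.trans e) with h | h
  · exact hx (h.1 ▸ hx')
  · exact hy (h.1 ▸ hx')

/-- The number of all factorizations, without any monotonicity condition. -/
theorem card_isFactorization (h : HasOrbitPair σ A) (hk : 0 < k) (hkA : k < A.card)
    (hkA' : k < Aᶜ.card) (hAl : A.card < l) (hAl' : Aᶜ.card < l)
    (hkl : k + l = Fintype.card α) :
    (univ.filter (IsFactorization σ A k l)).card = 2 * (A.card * Aᶜ.card * l) := by
  rw [← card_filter_add_card_filter_not (s := univ.filter (IsFactorization σ A k l))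
    (fun t => Preserves A t.1), filter_filter, filter_filter,
    card_joinFirst h hk (by omega) hkl]
  have e : (univ.filter fun t => IsFactorization σ A k l t ∧ Preserves A t.1) =
      univ.filter (IsCutJoin σ A k l) ∪ univ.filter (IsCutJoin σ Aᶜ k l) := by
    ext t
    simp only [mem_filter, mem_union, mem_univ, true_and]
    exact isFactorization_and_preserves_iff
  have hAc := card_add_card_compl A
  rw [e, card_union_of_disjoint, card_cutJoin h hk hkA hAl hkl,
    card_cutJoin h.compl hk hkA' hAl' hkl, compl_compl, ← hkl]
  · obtain ⟨a, ha⟩ := Nat.exists_eq_add_of_lt hkA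
    obtain ⟨b, hb⟩ := Nat.exists_eq_add_of_lt hkA'
    have hl : l = k + a + b + 2 := by omega
    rw [ha, hb, hl, show k + a + 1 - k = a + 1 by omega, show k + b + 1 - k = b + 1 by omega]
    ring
  · rw [disjoint_filter]
    exact fun t _ ht => not_isCutJoin_compl ht

end Factorizations

section Triples

open scoped Classical

/-- If `r` has order three, preserves `s`, and each `r`-cycle in `s` meets `p` exactly once, then
`p` cuts out a third of `s`. -/
theorem card_eq_three_mul_card_filter {β : Type*} (s : Finset β) (r : Perm β) (p : β → Prop)
    [DecidablePred p] (hr : ∀ x, x ∈ s ↔ r x ∈ s)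
    (hp : ∀ x ∈ s, (if p x then 1 else 0) + (if p (r x) then 1 else 0) +
      (if p (r (r x)) then 1 else 0) = 1) :
    s.card = 3 * (s.filter p).card := by
  have shift : ∀ f : β → ℕ, ∑ x ∈ s, f (r x) = ∑ x ∈ s, f x := fun f =>
    Finset.sum_equiv r hr fun _ _ => rfl
  have e1 := shift fun x => if p x then 1 else 0
  have e2 := shift fun x => if p (r x) then 1 else 0
  have h : ∑ x ∈ s, ((if p x then 1 else 0) + (if p (r x) then 1 else 0) +
      (if p (r (r x)) then 1 else 0)) = ∑ x ∈ s, 1 := sum_congr rfl hp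
  rw [sum_add_distrib, sum_add_distrib, ← card_eq_sum_ones] at h
  rw [card_filter]
  omega

variable {α : Type*} [Fintype α] [DecidableEq α]

/-- Triples `(u, w, t)` of distinct points, not all on the same side of `A`, for which the product
of the three-cycle `u ↦ w ↦ t ↦ u` with `σ` has orbits of sizes `k` and `l`. -/
def IsTriple (σ : Perm α) (A : Finset α) (k l : ℕ) (c : α × α × α) : Prop :=
  (c.1 ≠ c.2.1 ∧ c.2.1 ≠ c.2.2 ∧ c.1 ≠ c.2.2) ∧
    ¬ ((c.1 ∈ A ↔ c.2.2 ∈ A) ∧ (c.2.1 ∈ A ↔ c.2.2 ∈ A)) ∧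
    HasOrbitSizes (swap c.2.1 c.2.2 * swap c.1 c.2.2 * σ) k l

/-- The rotation `(u, w, t) ↦ (w, t, u)`. -/
def rotateTriple (α : Type*) : Perm (α × α × α) where
  toFun c := (c.2.1, c.2.2, c.1)
  invFun c := (c.2.2, c.1, c.2.1)
  left_inv _ := rfl
  right_inv _ := rfl

theorem swap_mul_swap_rotate {u w t : α} (huw : u ≠ w) (hwt : w ≠ t) (hut : u ≠ t) :
    swap w t * swap u t = swap t u * swap w u := by
  ext z
  simp only [Perm.mul_apply, swap_apply_def]
  grind

variable {σ : Perm α} {A : Finset α} {k l : ℕ}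

theorem isTriple_iff_rotate (c : α × α × α) :
    IsTriple σ A k l c ↔ IsTriple σ A k l (rotateTriple α c) := by
  obtain ⟨u, w, t⟩ := c
  simp only [IsTriple, rotateTriple, Equiv.coe_fn_mk]
  by_cases h : u ≠ w ∧ w ≠ t ∧ u ≠ t
  · rw [swap_mul_swap_rotate h.1 h.2.1 h.2.2]
    have : t ≠ u := h.2.2.symm
    have : w ≠ u := h.1.symm
    tauto
  · have h' : ¬ (w ≠ t ∧ t ≠ u ∧ w ≠ u) := by
      rintro ⟨a, b, c⟩
      exact h ⟨c.symm, a, b.symm⟩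
    simp only [h, h', false_and]

theorem HasOrbitPair.hasOrbitSizes_triple_iff (h : HasOrbitPair σ A) (hk : 0 < k)
    (hkA : k < A.card) (hAl : A.card < l) (hkl : k + l = Fintype.card α) {u w t : α}
    (hu : u ∈ A) (hw : w ∉ A) (ht : t ∈ A) (hut : u ≠ t) :
    HasOrbitSizes (swap w t * swap u t * σ) k l ↔ (σ ^ k) u = t := by
  obtain ⟨j, hj0, hj, e⟩ := exists_pos_pow_of_sameCycle ((h u t).2 (by tauto)) hut
  have := not_sameCycle_swap_mul_split hj0 hj e
  rw [mul_assoc, swap_comm w t,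
    h.hasOrbitSizes_split_join_iff hk hkA hAl hkl hu ht hut ht hw (by rwa [mem_orbitFinset])]

theorem card_isTriple_sameSide (h : HasOrbitPair σ A) (hk : 0 < k) (hkA : k < A.card)
    (hkA' : k < Aᶜ.card) (hAl : A.card < l) (hAl' : Aᶜ.card < l)
    (hkl : k + l = Fintype.card α) :
    ((univ.filter (IsTriple σ A k l)).filter fun c => (c.1 ∈ A ↔ c.2.2 ∈ A)).card =
      2 * (A.card * Aᶜ.card) := by
  have hcard : (A ×ˢ Aᶜ ∪ Aᶜ ×ˢ A).card = 2 * (A.card * Aᶜ.card) := by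
    rw [card_union_of_disjoint, card_product, card_product]
    · ring
    · rw [Finset.disjoint_left]
      rintro ⟨u, w⟩ h1 h2
      simp only [mem_product, mem_compl] at h1 h2
      tauto
  rw [← hcard]
  symm
  apply card_bij fun (c : α × α) _ => (c.1, c.2, (σ ^ k) c.1)
  · rintro ⟨u, w⟩ hc
    simp only [mem_union, mem_product, mem_compl] at hc
    have side : u ∈ A ↔ (σ ^ k) u ∈ A := (h u _).1 ⟨k, by simp⟩
    have hut : u ≠ (σ ^ k) u := by
      by_cases hu : u ∈ A
      · exact h.pow_apply_ne_self hk hkA hu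
      · exact h.compl.pow_apply_ne_self hk hkA' (by simpa using hu)
    have huw : u ≠ w := by
      rintro rfl
      tauto
    have hwt : w ≠ (σ ^ k) u := by
      intro e
      rw [← e] at side
      tauto
    refine mem_filter.2 ⟨mem_filter.2 ⟨mem_univ _, ⟨huw, hwt, hut⟩, ?_, ?_⟩, side⟩
    · dsimp only
      tauto
    · rcases hc with ⟨hu, hw⟩ | ⟨hu, hw⟩
      · exact (h.hasOrbitSizes_triple_iff hk hkA hAl hkl hu hw (side.1 hu) hut).2 rfl
      · refine (h.compl.hasOrbitSizes_triple_iff hk hkA' hAl' hkl ?_ ?_ ?_ hut).2 rfl <;>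
          rw [mem_compl] <;> tauto
  · rintro ⟨u, w⟩ - ⟨u', w'⟩ - he
    simp only [Prod.mk.injEq] at he ⊢
    tauto
  · rintro ⟨u, w, t⟩ hc
    obtain ⟨hc, side⟩ := mem_filter.1 hc
    obtain ⟨-, ⟨-, -, hut⟩, hn, ho⟩ := mem_filter.1 hc
    dsimp only at side hut hn ho
    have e : (σ ^ k) u = t := by
      by_cases hu : u ∈ A
      · exact (h.hasOrbitSizes_triple_iff hk hkA hAl hkl hu (by tauto) (by tauto) hut).1 ho
      · refine (h.compl.hasOrbitSizes_triple_iff hk hkA' hAl' hkl ?_ ?_ ?_ hut).1 ho <;>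
          rw [mem_compl] <;> tauto
    refine ⟨(u, w), ?_, by rw [e]⟩
    simp only [mem_union, mem_product, mem_compl]
    tauto

theorem card_isTriple (h : HasOrbitPair σ A) (hk : 0 < k) (hkA : k < A.card)
    (hkA' : k < Aᶜ.card) (hAl : A.card < l) (hAl' : Aᶜ.card < l)
    (hkl : k + l = Fintype.card α) :
    (univ.filter (IsTriple σ A k l)).card = 3 * (2 * (A.card * Aᶜ.card)) := by
  rw [← card_isTriple_sameSide h hk hkA hkA' hAl hAl' hkl]
  refine card_eq_three_mul_card_filter _ (rotateTriple α) _ (fun c => ?_) ?_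
  · rw [mem_filter, mem_filter, isTriple_iff_rotate]
    simp
  · rintro ⟨u, w, t⟩ hc
    obtain ⟨-, -, hn, -⟩ := mem_filter.1 hc
    simp only [rotateTriple, Equiv.coe_fn_mk]
    dsimp only at hn
    by_cases hu : u ∈ A <;> by_cases hw : w ∈ A <;> by_cases ht : t ∈ A <;>
      simp [hu, hw, ht] at hn ⊢

end Triples

section Monotone

open scoped Classical

variable {d : ℕ}

theorem permTop_swap {x y : Fin d} (h : x < y) : permTop (swap x y) = y := by
  rw [permTop, support_swap h.ne, sup_insert, sup_singleton]
  exact max_eq_right (Fin.lt_def.1 h).le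

theorem exists_lt_of_isSwap {τ : Perm (Fin d)} (h : τ.IsSwap) :
    ∃ x y, x < y ∧ τ = swap x y := by
  obtain ⟨x, y, hxy, rfl⟩ := h
  rcases lt_or_gt_of_ne hxy with h | h
  · exact ⟨x, y, h, rfl⟩
  · exact ⟨y, x, h, swap_comm _ _⟩

theorem permTop_conj {τ₁ τ₂ : Perm (Fin d)} (h₁ : τ₁.IsSwap) (h₂ : τ₂.IsSwap)
    (h : permTop τ₁ < permTop τ₂) : permTop (τ₁ * τ₂ * τ₁) = permTop τ₂ := by
  obtain ⟨a, b, hab, rfl⟩ := exists_lt_of_isSwap h₁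
  obtain ⟨c, t, hct, rfl⟩ := exists_lt_of_isSwap h₂
  rw [permTop_swap hab, permTop_swap hct] at h
  have hbt : b < t := Fin.lt_def.2 h
  have e : swap a b * swap c t * swap a b = swap (swap a b c) (swap a b t) := by
    have := Equiv.swap_apply_apply (swap a b) c t
    rw [this, swap_inv]
  have ht : swap a b t = t := swap_apply_of_ne_of_ne (hab.trans hbt).ne' hbt.ne'
  have hc : swap a b c < t := by
    rw [swap_apply_def]
    split_ifs
    exacts [hbt, hab.trans hbt, hct]
  rw [e, ht, permTop_swap hc, permTop_swap hct]

theorem IsSwap.conj_self {τ₁ τ₂ : Perm (Fin d)} (h₁ : τ₁.IsSwap) (h₂ : τ₂.IsSwap) :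
    (τ₁ * τ₂ * τ₁).IsSwap := by
  obtain ⟨a, b, hab, rfl⟩ := h₁
  obtain ⟨c, t, hct, rfl⟩ := h₂
  refine ⟨swap a b c, swap a b t, (swap a b).injective.ne hct, ?_⟩
  rw [Equiv.swap_apply_apply, swap_inv]

theorem IsSwap.mul_self_eq_one {τ : Perm (Fin d)} (h : τ.IsSwap) : τ * τ = 1 := by
  obtain ⟨a, b, -, rfl⟩ := h
  exact swap_mul_self a b

variable {σ : Perm (Fin d)} {A : Finset (Fin d)} {k l : ℕ}

theorem preserves_of_conj {τ₁ τ₂ : Perm (Fin d)} (h : τ₁ * τ₁ = 1) (h₁ : Preserves A τ₁)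
    (h₂ : Preserves A (τ₁ * τ₂ * τ₁)) : Preserves A τ₂ := by
  have := (h₁.mul h₂).mul h₁
  rwa [show τ₁ * (τ₁ * τ₂ * τ₁) * τ₁ = (τ₁ * τ₁) * τ₂ * (τ₁ * τ₁) by group, h, one_mul,
    mul_one] at this

/-- The Hurwitz move exchanges increasing and decreasing factorizations. -/
theorem card_increasing_eq_card_decreasing :
    (univ.filter fun t => IsFactorization σ A k l t ∧ permTop t.1 < permTop t.2).card =
      (univ.filter fun t => IsFactorization σ A k l t ∧ permTop t.2 < permTop t.1).card := by
  refine card_bij' (fun t _ => (t.1 * t.2 * t.1, t.1)) (fun t _ => (t.2, t.2 * t.1 * t.2))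
    ?_ ?_ ?_ ?_
  · rintro ⟨τ₁, τ₂⟩ ht
    obtain ⟨-, ⟨h1, h2, hn, ho⟩, hlt⟩ := mem_filter.1 ht
    dsimp only at h1 h2 hn ho hlt
    have hsq := IsSwap.mul_self_eq_one h1
    refine mem_filter.2 ⟨mem_univ _,
      ⟨IsSwap.conj_self h1 h2, h1, fun h' => hn ⟨h'.2, preserves_of_conj hsq h'.2 h'.1⟩, ?_⟩, ?_⟩
    · rwa [← mul_assoc, ← mul_assoc, hsq, one_mul]
    · rwa [permTop_conj h1 h2 hlt]
  · rintro ⟨τ₁, τ₂⟩ ht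
    obtain ⟨-, ⟨h1, h2, hn, ho⟩, hlt⟩ := mem_filter.1 ht
    dsimp only at h1 h2 hn ho hlt
    have hsq := IsSwap.mul_self_eq_one h2
    refine mem_filter.2 ⟨mem_univ _,
      ⟨h2, IsSwap.conj_self h2 h1, fun h' => hn ⟨preserves_of_conj hsq h'.1 h'.2, h'.1⟩, ?_⟩, ?_⟩
    · rwa [mul_assoc (τ₂ * τ₁), hsq, mul_one]
    · rwa [permTop_conj h2 h1 hlt]
  · rintro ⟨τ₁, τ₂⟩ ht
    obtain ⟨-, ⟨h1, -⟩, -⟩ := mem_filter.1 ht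
    have hsq : τ₁ * τ₁ = 1 := IsSwap.mul_self_eq_one h1
    dsimp only
    rw [show τ₁ * (τ₁ * τ₂ * τ₁) * τ₁ = (τ₁ * τ₁) * τ₂ * (τ₁ * τ₁) by group, hsq, one_mul, mul_one]
  · rintro ⟨τ₁, τ₂⟩ ht
    obtain ⟨-, ⟨-, h2, -⟩, -⟩ := mem_filter.1 ht
    have hsq : τ₂ * τ₂ = 1 := IsSwap.mul_self_eq_one h2
    dsimp only
    rw [show τ₂ * (τ₂ * τ₁ * τ₂) * τ₂ = (τ₂ * τ₂) * τ₁ * (τ₂ * τ₂) by group, hsq, one_mul, mul_one]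

theorem HasOrbitPair.not_hasOrbitSizes (h : HasOrbitPair σ A) (hkA : k < A.card)
    (hkA' : k < Aᶜ.card) : ¬ HasOrbitSizes σ k l := by
  rintro ⟨x, -, -, hx, -⟩
  by_cases hxA : x ∈ A
  · rw [h.orbitFinset_of_mem hxA] at hx
    omega
  · rw [h.orbitFinset_of_notMem hxA] at hx
    omega

theorem eq_of_swap_eq_swap_of_lt {x y x' y' : Fin d} (h : x < y) (h' : x' < y')
    (e : swap x y = swap x' y') : x = x' ∧ y = y' := by
  rcases eq_or_eq_of_swap_eq_swap h.ne e with e | e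
  · exact e
  · exact absurd (e.1 ▸ e.2 ▸ h) h'.asymm

theorem card_equalTops (h : HasOrbitPair σ A) (hk : 0 < k) (hkA : k < A.card)
    (hkA' : k < Aᶜ.card) (hAl : A.card < l) (hAl' : Aᶜ.card < l) (hkl : k + l = d) :
    (univ.filter fun t => IsFactorization σ A k l t ∧ permTop t.1 = permTop t.2).card =
      2 * (A.card * Aᶜ.card) := by
  have h3 := card_isTriple h hk hkA hkA' hAl hAl' (by rwa [Fintype.card_fin])
  rw [card_eq_three_mul_card_filter _ (rotateTriple (Fin d))
    (fun c => c.1 < c.2.2 ∧ c.2.1 < c.2.2)] at h3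
  · rw [← Nat.eq_of_mul_eq_mul_left (by norm_num) h3]
    symm
    apply card_bij fun (c : Fin d × Fin d × Fin d) _ => (swap c.1 c.2.2, swap c.2.1 c.2.2)
    · rintro ⟨u, w, t⟩ hc
      obtain ⟨hc, hut, hwt⟩ := mem_filter.1 hc
      obtain ⟨-, -, hn, ho⟩ := mem_filter.1 hc
      dsimp only at hut hwt hn ho
      refine mem_filter.2 ⟨mem_univ _,
        ⟨⟨u, t, hut.ne, rfl⟩, ⟨w, t, hwt.ne, rfl⟩, ?_, ho⟩, ?_⟩
      · rwa [preserves_swap_iff, preserves_swap_iff]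
      · rw [permTop_swap hut, permTop_swap hwt]
    · rintro ⟨u, w, t⟩ hc ⟨u', w', t'⟩ hc' he
      obtain ⟨-, hut, hwt⟩ := mem_filter.1 hc
      obtain ⟨-, hut', hwt'⟩ := mem_filter.1 hc'
      dsimp only at hut hwt hut' hwt'
      simp only [Prod.mk.injEq] at he ⊢
      have e1 := eq_of_swap_eq_swap_of_lt hut hut' he.1
      have e2 := eq_of_swap_eq_swap_of_lt hwt hwt' he.2
      exact ⟨e1.1, e2.1, e1.2⟩
    · rintro ⟨τ₁, τ₂⟩ ht
      obtain ⟨-, ⟨h1, h2, hn, ho⟩, heq⟩ := mem_filter.1 ht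
      dsimp only at h1 h2 hn ho heq
      obtain ⟨u, t, hut, rfl⟩ := exists_lt_of_isSwap h1
      obtain ⟨w, t', hwt, rfl⟩ := exists_lt_of_isSwap h2
      rw [permTop_swap hut, permTop_swap hwt] at heq
      obtain rfl : t = t' := Fin.ext heq
      have huw : u ≠ w := by
        rintro rfl
        rw [swap_mul_self, one_mul] at ho
        exact h.not_hasOrbitSizes hkA hkA' ho
      rw [preserves_swap_iff, preserves_swap_iff] at hn
      exact ⟨(u, w, t), mem_filter.2 ⟨mem_filter.2 ⟨mem_univ _, ⟨huw, hwt.ne, hut.ne⟩, hn, ho⟩,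
        hut, hwt⟩, rfl⟩
  · intro c
    rw [mem_filter, mem_filter, isTriple_iff_rotate]
    simp
  · rintro ⟨u, w, t⟩ hc
    obtain ⟨-, hd, -, -⟩ := mem_filter.1 hc
    simp only [rotateTriple, Equiv.coe_fn_mk]
    dsimp only at hd
    simp only [ne_eq, Fin.ext_iff] at hd
    simp only [Fin.lt_def]
    split_ifs <;> omega

/-- The strictly increasing and the weakly increasing factorizations. -/
theorem card_increasing (h : HasOrbitPair σ A) (hk : 0 < k) (hkA : k < A.card)
    (hkA' : k < Aᶜ.card) (hAl : A.card < l) (hAl' : Aᶜ.card < l) (hkl : k + l = d) :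
    (univ.filter fun t => IsFactorization σ A k l t ∧ permTop t.1 < permTop t.2).card =
      A.card * Aᶜ.card * (l - 1) ∧
    (univ.filter fun t => IsFactorization σ A k l t ∧ permTop t.1 ≤ permTop t.2).card =
      A.card * Aᶜ.card * (l + 1) := by
  have hT := card_isFactorization h hk hkA hkA' hAl hAl' (by rwa [Fintype.card_fin])
  have hE := card_equalTops h hk hkA hkA' hAl hAl' hkl
  have hS := card_increasing_eq_card_decreasing (σ := σ) (A := A) (k := k) (l := l)
  have hW : (univ.filter fun t => IsFactorization σ A k l t ∧ permTop t.1 ≤ permTop t.2).card =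
      (univ.filter fun t => IsFactorization σ A k l t ∧ permTop t.1 < permTop t.2).card +
      (univ.filter fun t => IsFactorization σ A k l t ∧ permTop t.1 = permTop t.2).card := by
    rw [← card_union_of_disjoint]
    · congr 1
      ext t
      simp only [mem_filter, mem_univ, true_and, mem_union, le_iff_lt_or_eq, and_or_left]
    · rw [disjoint_filter]
      rintro t - ⟨-, h1⟩ ⟨-, h2⟩
      exact h1.ne h2
  have hsum : (univ.filter (IsFactorization σ A k l)).card =
      (univ.filter fun t => IsFactorization σ A k l t ∧ permTop t.1 ≤ permTop t.2).card +
      (univ.filter fun t => IsFactorization σ A k l t ∧ permTop t.2 < permTop t.1).card := by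
    rw [← card_filter_add_card_filter_not (s := univ.filter (IsFactorization σ A k l))
      (fun t => permTop t.1 ≤ permTop t.2), filter_filter, filter_filter]
    simp only [not_le]
  obtain ⟨m, rfl⟩ : ∃ m, l = m + 1 := ⟨l - 1, by omega⟩
  have e1 : A.card * Aᶜ.card * (m + 1) = A.card * Aᶜ.card * m + A.card * Aᶜ.card := by ring
  have e2 : A.card * Aᶜ.card * (m + 1 + 1) = A.card * Aᶜ.card * m + 2 * (A.card * Aᶜ.card) := by
    ring
  rw [e2, Nat.add_sub_cancel]
  rw [e1] at hT
  omega

end Monotone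

section BlockCycle

theorem sameCycle_finRotate {n : ℕ} (x y : Fin n) : (finRotate n).SameCycle x y := by
  rcases lt_or_ge n 2 with h | h
  · have : x = y := Fin.ext (by omega)
    rw [this]
  · have hs : ∀ z : Fin n, finRotate n z ≠ z := fun z => by
      have : z ∈ (finRotate n).support := by
        rw [support_finRotate_of_le h]
        exact mem_univ z
      rwa [mem_support] at this
    exact (isCycle_finRotate_of_le h).sameCycle (hs x) (hs y)

theorem blockCyclePerm_zpow_apply {m : ℕ} (μ : Fin m → ℕ) (i : Fin m) (x : Fin (μ i)) (n : ℤ) :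
    (blockCyclePerm μ ^ n) (finSigmaFinEquiv ⟨i, x⟩) =
      finSigmaFinEquiv ⟨i, (finRotate (μ i) ^ n) x⟩ := by
  have h1 : ∀ (j : Fin m) (z : Fin (μ j)), blockCyclePerm μ (finSigmaFinEquiv ⟨j, z⟩) =
      finSigmaFinEquiv ⟨j, finRotate (μ j) z⟩ := fun j z => by
    simp [blockCyclePerm, Equiv.permCongr_apply]
  induction n with
  | zero => simp
  | succ n ih =>
    rw [add_comm, zpow_one_add, Perm.mul_apply, ih, h1, zpow_one_add, Perm.mul_apply]
  | pred n ih =>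
    apply (blockCyclePerm μ).injective
    rw [h1, ← Perm.mul_apply, ← Perm.mul_apply, ← zpow_one_add, ← zpow_one_add,
      add_sub_cancel, ih]

theorem sameCycle_blockCyclePerm_iff {m : ℕ} (μ : Fin m → ℕ) (x y : Fin (∑ i, μ i)) :
    (blockCyclePerm μ).SameCycle x y ↔
      (finSigmaFinEquiv.symm x).1 = (finSigmaFinEquiv.symm y).1 := by
  obtain ⟨⟨i, x⟩, rfl⟩ := finSigmaFinEquiv.surjective x
  obtain ⟨⟨j, y⟩, rfl⟩ := finSigmaFinEquiv.surjective y
  simp only [Equiv.symm_apply_apply]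
  constructor
  · rintro ⟨n, hn⟩
    rw [blockCyclePerm_zpow_apply] at hn
    exact congrArg Sigma.fst (finSigmaFinEquiv.injective hn)
  · rintro rfl
    obtain ⟨n, hn⟩ := sameCycle_finRotate x y
    exact ⟨n, by rw [blockCyclePerm_zpow_apply, hn]⟩

/-- The `i`-th block of consecutive points. -/
def block {m : ℕ} (μ : Fin m → ℕ) (i : Fin m) : Finset (Fin (∑ i, μ i)) :=
  univ.filter fun x => (finSigmaFinEquiv.symm x).1 = i

theorem card_block {m : ℕ} (μ : Fin m → ℕ) (i : Fin m) : (block μ i).card = μ i := by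
  conv_rhs => rw [← Fintype.card_fin (μ i), ← card_univ]
  symm
  apply card_bij fun (x : Fin (μ i)) _ => finSigmaFinEquiv ⟨i, x⟩
  · intro x _
    simp [block]
  · intro x _ y _ h
    simpa using finSigmaFinEquiv.injective h
  · intro z hz
    obtain ⟨⟨j, x⟩, rfl⟩ := finSigmaFinEquiv.surjective z
    simp only [block, mem_filter, mem_univ, true_and, Equiv.symm_apply_apply] at hz
    subst hz
    exact ⟨x, mem_univ _, rfl⟩

theorem hasOrbitPair_blockCyclePerm (μ : Fin 2 → ℕ) :
    HasOrbitPair (blockCyclePerm μ) (block μ 0) := by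
  intro x y
  rw [sameCycle_blockCyclePerm_iff]
  simp only [block, mem_filter, mem_univ, true_and]
  omega

end BlockCycle

section Listing

variable {d k l : ℕ} {ρ : Perm (Fin d)}

theorem coe_orbitFinset (ρ : Perm (Fin d)) (x : Fin d) :
    (orbitFinset ρ x : Set (Fin d)) = {y | ρ.SameCycle x y} := by
  ext y
  simp [mem_orbitFinset]

theorem hasOrbitSizes_of_isOrbitListing {B : Fin 2 → Set (Fin d)}
    (h : IsOrbitListing ρ ![k, l] B) : HasOrbitSizes ρ k l := by
  obtain ⟨horb, hinj, -, hcard⟩ := h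
  obtain ⟨x, hx⟩ := horb 0
  obtain ⟨y, hy⟩ := horb 1
  have h0 := hcard 0
  have h1 := hcard 1
  rw [hx, ← coe_orbitFinset, Set.ncard_coe_finset] at h0
  rw [hy, ← coe_orbitFinset, Set.ncard_coe_finset] at h1
  refine ⟨x, y, fun hs => ?_, by simpa using h0, by simpa using h1⟩
  have : B 0 = B 1 := by
    rw [hx, hy, ← coe_orbitFinset, ← coe_orbitFinset, orbitFinset_eq_of_sameCycle hs]
  exact absurd (hinj this) (by decide)

theorem exists_isOrbitListing (hkl : k + l = d) (h : HasOrbitSizes ρ k l) :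
    ∃ B, IsOrbitListing ρ ![k, l] B := by
  obtain ⟨x, y, hn, hx, hy⟩ := h
  have hne : {z | ρ.SameCycle x z} ≠ {z | ρ.SameCycle y z} := fun e => by
    have : y ∈ {z | ρ.SameCycle x z} := by
      rw [e]
      exact SameCycle.refl _ _
    exact hn this
  refine ⟨![{z | ρ.SameCycle x z}, {z | ρ.SameCycle y z}], ?_, ?_, ?_, ?_⟩
  · intro j
    fin_cases j
    · exact ⟨x, rfl⟩
    · exact ⟨y, rfl⟩
  · intro i j hij
    fin_cases i <;> fin_cases j
    · rfl
    · exact absurd hij hne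
    · exact absurd hij hne.symm
    · rfl
  · intro z
    rcases sameCycle_or_of_card_add hn (by rw [hx, hy, hkl, Fintype.card_fin]) z with h | h
    · exact ⟨0, h⟩
    · exact ⟨1, h⟩
  · intro j
    fin_cases j
    · simp [← coe_orbitFinset, hx]
    · simp [← coe_orbitFinset, hy]

theorem isOrbitListing_unique {n : ℕ} {ν : Fin n → ℕ} (hν : Function.Injective ν)
    {B B' : Fin n → Set (Fin d)} (h : IsOrbitListing ρ ν B) (h' : IsOrbitListing ρ ν B') :
    B = B' := by
  funext j
  obtain ⟨x, hx⟩ := h.1 j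
  obtain ⟨i, hi⟩ := h'.2.2.1 x
  obtain ⟨y, hy⟩ := h'.1 i
  rw [hy] at hi
  have e : B j = B' i := by
    rw [hx, hy, ← coe_orbitFinset, ← coe_orbitFinset,
      orbitFinset_eq_of_sameCycle (show ρ.SameCycle y x from hi)]
  have : j = i := hν (by rw [← h.2.2.2 j, ← h'.2.2.2 i, e])
  rw [e, this]

theorem hasOrbitSizes_inv_iff : HasOrbitSizes ρ⁻¹ k l ↔ HasOrbitSizes ρ k l := by
  have e : ∀ x, orbitFinset ρ⁻¹ x = orbitFinset ρ x := fun x => by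
    ext y
    rw [mem_orbitFinset, mem_orbitFinset, sameCycle_inv]
  simp only [HasOrbitSizes, e, sameCycle_inv]

end Listing

section Transitivity

variable {d : ℕ} {σ : Perm (Fin d)} {A : Finset (Fin d)}

theorem Preserves.inv {τ : Perm (Fin d)} (h : Preserves A τ) : Preserves A τ⁻¹ := fun z => by
  simpa using (h (τ⁻¹ z)).symm

theorem preserves_of_mem_closure {S : Set (Perm (Fin d))} (hS : ∀ τ ∈ S, Preserves A τ)
    {g : Perm (Fin d)} (hg : g ∈ Subgroup.closure S) : Preserves A g := by
  induction hg using Subgroup.closure_induction with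
  | mem x hx => exact hS x hx
  | one => exact fun z => Iff.rfl
  | mul x y _ _ hx hy => exact hx.mul hy
  | inv x _ hx => exact hx.inv

theorem HasOrbitPair.preserves (h : HasOrbitPair σ A) : Preserves A σ := fun z =>
  (h z (σ z)).1 ⟨1, by simp⟩

theorem isPretransitive_iff (h : HasOrbitPair σ A) (hA : A.Nonempty) (hA' : Aᶜ.Nonempty)
    {σ₂ : Perm (Fin d)} {τ : Fin 2 → Perm (Fin d)} (hprod : σ₂ * (τ 1 * τ 0) * σ = 1) :
    MulAction.IsPretransitive (Subgroup.closure ({σ, σ₂} ∪ Set.range τ)) (Fin d) ↔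
      ¬ (Preserves A (τ 0) ∧ Preserves A (τ 1)) := by
  constructor
  · rintro htr ⟨h0, h1⟩
    obtain ⟨x, hx⟩ := hA
    obtain ⟨y, hy⟩ := hA'
    obtain ⟨⟨g, hg⟩, hgx⟩ := htr.exists_smul_eq x y
    have hσ₂ : Preserves A σ₂ := by
      have e : σ₂ = (τ 1 * τ 0 * σ)⁻¹ := by
        rw [eq_inv_iff_mul_eq_one, ← hprod, ← mul_assoc]
      rw [e]
      exact ((h1.mul h0).mul h.preserves).inv
    have hgA : Preserves A g := by
      refine preserves_of_mem_closure ?_ hg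
      rintro τ' ((rfl | rfl) | ⟨i, rfl⟩)
      · exact h.preserves
      · exact hσ₂
      · fin_cases i
        · exact h0
        · exact h1
    have hgx' : g x = y := hgx
    rw [mem_compl, ← hgx'] at hy
    exact hy ((hgA x).1 hx)
  · intro hn
    set H := Subgroup.closure ({σ, σ₂} ∪ Set.range τ) with hH
    have hσ : σ ∈ H := Subgroup.subset_closure (by simp)
    have hτ : ∀ i, τ i ∈ H := fun i => Subgroup.subset_closure (by simp)
    have key : ∀ g ∈ H, ∀ x y, g x = y → MulAction.orbitRel H (Fin d) x y := by
      rintro g hg x _ rfl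
      exact (MulAction.orbitRel H (Fin d)).symm ⟨⟨g, hg⟩, rfl⟩
    have hside : ∀ x y, (x ∈ A ↔ y ∈ A) → MulAction.orbitRel H (Fin d) x y := by
      intro x y hxy
      obtain ⟨n, hn⟩ := (h x y).2 hxy
      exact key _ (H.zpow_mem hσ n) x y hn
    obtain ⟨i, z, hz⟩ : ∃ i z, ¬ (z ∈ A ↔ τ i z ∈ A) := by
      by_contra! hcon
      exact hn ⟨hcon 0, hcon 1⟩
    have hcross := key _ (hτ i) z _ rfl
    have hall : ∀ x, MulAction.orbitRel H (Fin d) x z := by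
      intro x
      by_cases hx : x ∈ A ↔ z ∈ A
      · exact hside x z hx
      · exact (MulAction.orbitRel H (Fin d)).trans (hside x (τ i z) (by tauto))
          ((MulAction.orbitRel H (Fin d)).symm hcross)
    refine ⟨fun x y => ?_⟩
    exact (MulAction.orbitRel H (Fin d)).trans (hall y) ((MulAction.orbitRel H (Fin d)).symm (hall x))

end Transitivity

section Count

open scoped Classical

/-- The tuples counted by `Mcount` correspond to the factorizations subject to the same
monotonicity condition. -/
theorem natCard_tuples_eq {d k l : ℕ} {σ : Perm (Fin d)} {A : Finset (Fin d)}
    (h : HasOrbitPair σ A) (hA : A.Nonempty) (hA' : Aᶜ.Nonempty) (hne : k ≠ l) (hkl : k + l = d)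
    (M : (Fin 2 → Perm (Fin d)) → Prop) (R : Perm (Fin d) → Perm (Fin d) → Prop)
    [DecidableRel R]
    (hMR : ∀ τ, M τ ↔ R (τ 0) (τ 1)) :
    Nat.card { t : (Fin 2 → Perm (Fin d)) × Perm (Fin d) × (Fin 2 → Set (Fin d)) //
      (∀ i, (t.1 i).IsSwap) ∧ M t.1 ∧
      t.2.1 * (List.ofFn t.1).reverse.prod * σ = 1 ∧
      MulAction.IsPretransitive (Subgroup.closure ({σ, t.2.1} ∪ Set.range t.1)) (Fin d) ∧
      IsOrbitListing t.2.1 ![k, l] t.2.2 } =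
    (univ.filter fun t => IsFactorization σ A k l t ∧ R t.1 t.2).card := by
  have hlist : ∀ τ : Fin 2 → Perm (Fin d), (List.ofFn τ).reverse.prod = τ 1 * τ 0 := fun τ => by
    simp [List.ofFn_succ]
  have hinv : ∀ {σ₂ : Perm (Fin d)} {τ : Fin 2 → Perm (Fin d)},
      σ₂ * (τ 1 * τ 0) * σ = 1 → σ₂ = (τ 1 * τ 0 * σ)⁻¹ := fun e => by
    rw [eq_inv_iff_mul_eq_one, ← e, ← mul_assoc]
  have hν : Function.Injective ![k, l] := by
    intro i j hij
    fin_cases i <;> fin_cases j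
    · rfl
    · exact absurd hij hne
    · exact absurd hij hne.symm
    · rfl
  simp only [hlist]
  rw [← Fintype.card_coe, ← Nat.card_eq_fintype_card]
  refine Nat.card_eq_of_bijective (fun t => ⟨(t.1.1 0, t.1.1 1), ?_⟩) ⟨?_, ?_⟩
  · obtain ⟨⟨τ, σ₂, B⟩, hsw, hM, hprod, htr, hB⟩ := t
    refine mem_filter.2 ⟨mem_univ _,
      ⟨hsw 0, hsw 1, (isPretransitive_iff h hA hA' hprod).1 htr, ?_⟩, (hMR τ).1 hM⟩
    have := hasOrbitSizes_of_isOrbitListing hB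
    rwa [hinv hprod, hasOrbitSizes_inv_iff] at this
  · rintro ⟨⟨τ, σ₂, B⟩, hsw, hM, hprod, htr, hB⟩ ⟨⟨τ', σ₂', B'⟩, hsw', hM', hprod', htr', hB'⟩ he
    simp only [Subtype.mk.injEq, Prod.mk.injEq] at he
    dsimp only at hprod hprod' hB hB'
    obtain rfl : τ = τ' := by
      funext i
      fin_cases i
      · exact he.1
      · exact he.2
    obtain rfl : σ₂ = σ₂' := (hinv hprod).trans (hinv hprod').symm
    obtain rfl := isOrbitListing_unique hν hB hB'
    rfl
  · rintro ⟨⟨τ₁, τ₂⟩, ht⟩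
    obtain ⟨-, ⟨h1, h2, hn, ho⟩, hR⟩ := mem_filter.1 ht
    obtain ⟨B, hB⟩ := exists_isOrbitListing hkl (hasOrbitSizes_inv_iff.2 ho)
    have hprod : (τ₂ * τ₁ * σ)⁻¹ * (![τ₁, τ₂] 1 * ![τ₁, τ₂] 0) * σ = 1 := by
      rw [mul_assoc]
      exact inv_mul_cancel _
    refine ⟨⟨(![τ₁, τ₂], (τ₂ * τ₁ * σ)⁻¹, B), ?_, (hMR _).2 hR, hprod,
      (isPretransitive_iff h hA hA' hprod).2 hn, hB⟩, rfl⟩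
    intro i
    fin_cases i
    · exact h1
    · exact h2

theorem monCond_strict_iff {d : ℕ} (τ : Fin 2 → Perm (Fin d)) :
    MonCond 0 2 τ ↔ permTop (τ 0) < permTop (τ 1) := by
  constructor
  · intro h
    exact (h 0 1 rfl).2 (by simp) (by simp)
  · intro h i j hij
    obtain rfl : i = 0 := Fin.ext (by simp; omega)
    obtain rfl : j = 1 := Fin.ext (by simpa using hij)
    exact ⟨fun h' => absurd h' (by simp), fun _ _ => h⟩

theorem monCond_weak_iff {d : ℕ} (τ : Fin 2 → Perm (Fin d)) :
    MonCond 2 0 τ ↔ permTop (τ 0) ≤ permTop (τ 1) := by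
  constructor
  · intro h
    exact (h 0 1 rfl).1 (by simp)
  · intro h i j hij
    obtain rfl : i = 0 := Fin.ext (by simp; omega)
    obtain rfl : j = 1 := Fin.ext (by simpa using hij)
    exact ⟨fun _ => h, fun h' => absurd h' (by simp)⟩

end Count

/-- In the chamber `ν₁ < μ₁ < ν₂`, `ν₁ < μ₂ < ν₂`, the strictly monotone count
`M_{0,2,0;(μ₁,μ₂),(ν₁,ν₂)}` equals `μ₁·μ₂·(ν₂-1)` and the (weakly) monotone count
`M_{2,0,0;(μ₁,μ₂),(ν₁,ν₂)}` equals `μ₁·μ₂·(ν₂+1)`. -/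
theorem strictly_monotone_count_chamberFour
    (μ₁ μ₂ ν₁ ν₂ : ℕ)
    (hμ₁ : 0 < μ₁) (hμ₂ : 0 < μ₂) (hν₁ : 0 < ν₁) (hν₂ : 0 < ν₂)
    (hd : μ₁ + μ₂ = ν₁ + ν₂)
    (c1 : ν₁ < μ₁) (c2 : μ₁ < ν₂) (c3 : ν₁ < μ₂) (c4 : μ₂ < ν₂) :
    Mcount 0 2 0 ![μ₁, μ₂] ![ν₁, ν₂] = μ₁ * μ₂ * (ν₂ - 1) ∧
    Mcount 2 0 0 ![μ₁, μ₂] ![ν₁, ν₂] = μ₁ * μ₂ * (ν₂ + 1) := by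
  have h := hasOrbitPair_blockCyclePerm ![μ₁, μ₂]
  have hsum : ∑ i, ![μ₁, μ₂] i = μ₁ + μ₂ := by simp [Fin.sum_univ_two]
  have hA : (block ![μ₁, μ₂] 0).card = μ₁ := card_block _ _
  have hA' : (block ![μ₁, μ₂] 0)ᶜ.card = μ₂ := by
    rw [card_compl, hA, Fintype.card_fin, hsum, Nat.add_sub_cancel_left]
  have hkl : ν₁ + ν₂ = ∑ i, ![μ₁, μ₂] i := by rw [hsum, hd]
  have hcount := card_increasing h hν₁ (by rwa [hA]) (by rwa [hA']) (by rwa [hA]) (by rwa [hA'])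
    hkl
  rw [hA, hA'] at hcount
  have hne : (block ![μ₁, μ₂] 0).Nonempty := card_pos.1 (by rwa [hA])
  have hne' : (block ![μ₁, μ₂] 0)ᶜ.Nonempty := card_pos.1 (by rwa [hA'])
  rw [← hcount.1, ← hcount.2]
  exact ⟨natCard_tuples_eq h hne hne' (by omega) hkl (MonCond 0 2)
      (fun τ₁ τ₂ => permTop τ₁ < permTop τ₂) monCond_strict_iff,
    natCard_tuples_eq h hne hne' (by omega) hkl (MonCond 2 0)
      (fun τ₁ τ₂ => permTop τ₁ ≤ permTop τ₂) monCond_weak_iff⟩
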